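/- arXiv:2301.11137 — 2 statements merged into one kernel-verified Lean document; each statement's English description precedes it below -/
import Mathlib

section
/- Let q, x, y be complex numbers with |q| < 1, |x| ≤ 1 and |y| ≤ 1. Then 1/((xq;q²)_∞ (yq²;q⁴)_∞) = Σ_{n₁,n₂,n₃,n₄ ≥ 0} x^{n₁+n₂+2n₄} y^{n₂+n₃} q^{2C(n₁,2) + 2n₁n₂ + 4n₁n₃ + 4n₃n₄ + n₁ + 3n₂ + 2n₃ + 2n₄} (1 + x²y q^{4+4(n₁+n₃)}) / ((q²;q²)_{n₁}(q²;q²)_{n₂}(q⁴;q⁴)_{n₃}(q⁴;q⁴)_{n₄}), where the quadruple series converges absolutely. -/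
/-- The finite q-Pochhammer symbol `(a; q)_n = ∏_{k=0}^{n-1} (1 - a q^k)`. -/
noncomputable def qPoch (a q : ℂ) (n : ℕ) : ℂ :=
  ∏ k ∈ Finset.range n, (1 - a * q ^ k)

/-- The infinite q-Pochhammer symbol `(a; q)_∞ = ∏_{k=0}^{∞} (1 - a q^k)`. -/
noncomputable def qPochInf (a q : ℂ) : ℂ :=
  ∏' k : ℕ, (1 - a * q ^ k)

open Filter Topology

lemma qPoch_zero (a q : ℂ) : qPoch a q 0 = 1 := by simp [qPoch]

lemma qPoch_succ (a q : ℂ) (n : ℕ) : qPoch a q (n + 1) = qPoch a q n * (1 - a * q ^ n) := by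
  simp [qPoch, Finset.prod_range_succ]

lemma qPoch_succ_left (a q : ℂ) (n : ℕ) :
    qPoch a q (n + 1) = (1 - a) * qPoch (a * q) q n := by
  simp only [qPoch, Finset.prod_range_succ', pow_zero, mul_one, pow_succ']
  rw [mul_comm]
  simp only [mul_assoc]

lemma norm_mul_pow_lt_one {a q : ℂ} (ha : ‖a‖ < 1) (hq : ‖q‖ < 1) (n : ℕ) :
    ‖a * q ^ n‖ < 1 := by
  rw [norm_mul, norm_pow]
  exact mul_lt_one_of_nonneg_of_lt_one_left (norm_nonneg _) ha (pow_le_one₀ (norm_nonneg _) hq.le)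

lemma norm_sq_lt_one {q : ℂ} (hq : ‖q‖ < 1) : ‖q ^ 2‖ < 1 := by
  rw [norm_pow]; exact pow_lt_one₀ (norm_nonneg _) hq two_ne_zero

lemma norm_pow_four_lt_one {q : ℂ} (hq : ‖q‖ < 1) : ‖q ^ 4‖ < 1 := by
  rw [norm_pow]; exact pow_lt_one₀ (norm_nonneg _) hq four_ne_zero

lemma one_sub_ne_zero_of_norm_lt_one {a : ℂ} (ha : ‖a‖ < 1) : 1 - a ≠ 0 := by
  intro h
  rw [← sub_eq_zero.mp h] at ha
  simp at ha

lemma qPoch_ne_zero {a q : ℂ} (ha : ‖a‖ < 1) (hq : ‖q‖ < 1) (n : ℕ) : qPoch a q n ≠ 0 :=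
  Finset.prod_ne_zero_iff.mpr fun k _ =>
    one_sub_ne_zero_of_norm_lt_one (norm_mul_pow_lt_one ha hq k)

lemma summable_norm_mul_pow (a : ℂ) {q : ℂ} (hq : ‖q‖ < 1) :
    Summable fun k : ℕ => ‖-(a * q ^ k)‖ := by
  simp only [norm_neg, norm_mul, norm_pow]
  exact (summable_geometric_of_lt_one (norm_nonneg _) hq).mul_left _

lemma tendsto_qPoch (a : ℂ) {q : ℂ} (hq : ‖q‖ < 1) :
    Tendsto (qPoch a q) atTop (𝓝 (qPochInf a q)) := by
  have h := (multipliable_one_add_of_summable (summable_norm_mul_pow a hq)).tendsto_prod_tprod_nat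
  simp only [← sub_eq_add_neg] at h
  exact h

lemma qPochInf_ne_zero {a q : ℂ} (ha : ‖a‖ < 1) (hq : ‖q‖ < 1) : qPochInf a q ≠ 0 := by
  have h := tprod_one_add_ne_zero_of_summable (f := fun k : ℕ => -(a * q ^ k))
    (fun k => by
      rw [← sub_eq_add_neg]
      exact one_sub_ne_zero_of_norm_lt_one (norm_mul_pow_lt_one ha hq k))
    (summable_norm_mul_pow a hq)
  simp only [← sub_eq_add_neg] at h
  exact h

lemma qPochInf_eq_one_sub_mul (a : ℂ) {q : ℂ} (hq : ‖q‖ < 1) :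
    qPochInf a q = (1 - a) * qPochInf (a * q) q := by
  refine tendsto_nhds_unique ((tendsto_add_atTop_iff_nat 1).mpr (tendsto_qPoch a hq)) ?_
  simp only [qPoch_succ_left]
  exact (tendsto_qPoch (a * q) hq).const_mul _

lemma qPoch_mul_qPochInf (a : ℂ) {q : ℂ} (hq : ‖q‖ < 1) (n : ℕ) :
    qPoch a q n * qPochInf (a * q ^ n) q = qPochInf a q := by
  induction n with
  | zero => simp [qPoch_zero]
  | succ n ih =>
    rw [← ih, qPochInf_eq_one_sub_mul (a * q ^ n) hq, qPoch_succ]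
    ring_nf

lemma qPochInf_sq (a : ℂ) {q : ℂ} (hq : ‖q‖ < 1) :
    qPochInf (a ^ 2) (q ^ 2) = qPochInf a q * qPochInf (-a) q := by
  have hq2 := norm_sq_lt_one hq
  refine tendsto_nhds_unique (tendsto_qPoch _ hq2)
    (((tendsto_qPoch a hq).mul (tendsto_qPoch (-a) hq)).congr fun n => ?_)
  simp only [qPoch, ← Finset.prod_mul_distrib]
  exact Finset.prod_congr rfl fun k _ => by ring

lemma exists_norm_qPoch_le {q : ℂ} (hq : ‖q‖ < 1) :
    ∃ M : ℝ, 0 ≤ M ∧ ∀ a : ℂ, ‖a‖ ≤ 1 → (∀ n, ‖qPoch a q n‖ ≤ M) ∧ ‖qPochInf a q‖ ≤ M := by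
  have hs := summable_geometric_of_lt_one (norm_nonneg q) hq
  refine ⟨Real.exp (∑' k, ‖q‖ ^ k), (Real.exp_pos _).le, fun a ha => ?_⟩
  have h : ∀ n, ‖qPoch a q n‖ ≤ Real.exp (∑' k, ‖q‖ ^ k) := fun n => by
    calc ‖qPoch a q n‖ = ∏ k ∈ Finset.range n, ‖1 - a * q ^ k‖ := by simp [qPoch]
      _ ≤ ∏ k ∈ Finset.range n, (1 + ‖q‖ ^ k) := by
        refine Finset.prod_le_prod (fun _ _ => norm_nonneg _) fun k _ => ?_
        refine (norm_sub_le _ _).trans ?_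
        rw [norm_one, norm_mul, norm_pow]
        gcongr
        exact mul_le_of_le_one_left (by positivity) ha
      _ ≤ Real.exp (∑ k ∈ Finset.range n, ‖q‖ ^ k) :=
        Real.prod_one_add_le_exp_sum _ fun _ => by positivity
      _ ≤ _ := Real.exp_le_exp.mpr (hs.sum_le_tsum _ fun _ _ => by positivity)
  exact ⟨h, le_of_tendsto (tendsto_qPoch a hq).norm (Eventually.of_forall h)⟩

lemma exists_norm_inv_qPoch_le {q : ℂ} (hq : ‖q‖ < 1) :
    ∃ M : ℝ, 0 ≤ M ∧ ∀ n, ‖(qPoch q q n)⁻¹‖ ≤ M := by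
  have h := ((tendsto_qPoch q hq).inv₀ (qPochInf_ne_zero hq hq)).norm
  obtain ⟨M, hM⟩ := h.bddAbove_range
  exact ⟨M, (norm_nonneg _).trans (hM ⟨0, rfl⟩), fun n => hM ⟨n, rfl⟩⟩

lemma tendsto_qPochInf_zero {q : ℂ} (hq : ‖q‖ < 1) :
    Tendsto (fun a => qPochInf a q) (𝓝 0) (𝓝 1) := by
  have h := tendsto_tprod_one_add_of_dominated_convergence
    (𝓕 := 𝓝 (0 : ℂ)) (f := fun a (k : ℕ) => -(a * q ^ k)) (g := fun _ => 0)
    (bound := fun k => ‖q‖ ^ k) (summable_geometric_of_lt_one (norm_nonneg q) hq)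
    (fun k => by
      have : Continuous fun a : ℂ => -(a * q ^ k) := by fun_prop
      simpa using this.tendsto 0)
    (by
      filter_upwards [Metric.ball_mem_nhds (0 : ℂ) one_pos] with a ha k
      rw [norm_neg, norm_mul, norm_pow]
      exact mul_le_of_le_one_left (by positivity) (mem_ball_zero_iff.mp ha).le)
  simpa [qPochInf, ← sub_eq_add_neg] using h

lemma exists_norm_qPoch_div_le {a q : ℂ} (ha : ‖a‖ ≤ 1) (hq : ‖q‖ < 1) :
    ∃ M : ℝ, ∀ n, ‖qPoch a q n / qPoch q q n‖ ≤ M := by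
  obtain ⟨M, hM0, hM⟩ := exists_norm_qPoch_le hq
  obtain ⟨N, _, hN⟩ := exists_norm_inv_qPoch_le hq
  refine ⟨M * N, fun n => ?_⟩
  rw [div_eq_mul_inv, norm_mul]
  exact mul_le_mul ((hM a ha).1 n) (hN n) (norm_nonneg _) hM0

lemma summable_qBinomial {a q z : ℂ} (ha : ‖a‖ ≤ 1) (hq : ‖q‖ < 1) (hz : ‖z‖ < 1) :
    Summable fun n : ℕ => qPoch a q n / qPoch q q n * z ^ n := by
  obtain ⟨M, hM⟩ := exists_norm_qPoch_div_le ha hq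
  refine .of_norm_bounded ((summable_geometric_of_lt_one (norm_nonneg z) hz).mul_left M) fun n => ?_
  rw [norm_mul, norm_pow]
  exact mul_le_mul_of_nonneg_right (hM n) (by positivity)

lemma tsum_qBinomial_step {a q z : ℂ} (ha : ‖a‖ ≤ 1) (hq : ‖q‖ < 1) (hz : ‖z‖ < 1) :
    (1 - z) * ∑' n : ℕ, qPoch a q n / qPoch q q n * z ^ n =
      (1 - a * z) * ∑' n : ℕ, qPoch a q n / qPoch q q n * (z * q) ^ n := by
  have hzq : ‖z * q‖ < 1 := by simpa using norm_mul_pow_lt_one hz hq 1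
  have h₁ := summable_qBinomial ha hq hz
  have h₂ := summable_qBinomial ha hq hzq
  have key : ∑' n : ℕ, (qPoch a q n / qPoch q q n * z ^ n
        - qPoch a q n / qPoch q q n * (z * q) ^ n) =
      ∑' n : ℕ, (z * (qPoch a q n / qPoch q q n * z ^ n)
        - a * z * (qPoch a q n / qPoch q q n * (z * q) ^ n)) := by
    rw [(h₁.sub h₂).tsum_eq_zero_add]
    simp only [pow_zero, sub_self, zero_add]
    refine tsum_congr fun n => ?_
    have hn := qPoch_ne_zero hq hq n
    have hn' : 1 - q ^ (n + 1) ≠ 0 := by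
      rw [pow_succ']
      exact one_sub_ne_zero_of_norm_lt_one (norm_mul_pow_lt_one hq hq n)
    rw [qPoch_succ, qPoch_succ, ← pow_succ']
    field_simp
    ring
  rw [h₁.tsum_sub h₂, (h₁.mul_left z).tsum_sub (h₂.mul_left (a * z)), tsum_mul_left,
    tsum_mul_left] at key
  linear_combination key

/-- The `q`-binomial theorem. -/
theorem qPochInf_mul_tsum_qBinomial {a q z : ℂ} (ha : ‖a‖ ≤ 1) (hq : ‖q‖ < 1) (hz : ‖z‖ < 1) :
    qPochInf z q * ∑' n : ℕ, qPoch a q n / qPoch q q n * z ^ n = qPochInf (a * z) q := by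
  have hiter : ∀ m : ℕ, qPoch z q m * ∑' n : ℕ, qPoch a q n / qPoch q q n * z ^ n =
      qPoch (a * z) q m * ∑' n : ℕ, qPoch a q n / qPoch q q n * (z * q ^ m) ^ n := by
    intro m
    induction m with
    | zero => simp [qPoch_zero]
    | succ m ih =>
      have h := tsum_qBinomial_step ha hq (norm_mul_pow_lt_one hz hq m)
      simp only [mul_assoc z, ← pow_succ] at h
      rw [qPoch_succ, qPoch_succ]
      linear_combination (1 - z * q ^ m) * ih + qPoch (a * z) q m * h
  have hlim : Tendsto (fun m : ℕ => ∑' n : ℕ, qPoch a q n / qPoch q q n * (z * q ^ m) ^ n) atTop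
      (𝓝 (∑' n : ℕ, qPoch a q n / qPoch q q n * 0 ^ n)) := by
    obtain ⟨M, hM⟩ := exists_norm_qPoch_div_le ha hq
    refine tendsto_tsum_of_dominated_convergence
      ((summable_geometric_of_lt_one (norm_nonneg z) hz).mul_left M) (fun k => ?_)
      (Eventually.of_forall fun m k => ?_)
    · have h0 : Tendsto (fun m : ℕ => z * q ^ m) atTop (𝓝 0) := by
        simpa using (tendsto_pow_atTop_nhds_zero_of_norm_lt_one hq).const_mul z
      exact (h0.pow k).const_mul _
    · rw [norm_mul, norm_pow]
      refine mul_le_mul (hM k) (pow_le_pow_left₀ (norm_nonneg _) ?_ k) (by positivity)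
        ((norm_nonneg _).trans (hM 0))
      rw [norm_mul, norm_pow]
      exact mul_le_of_le_one_right (norm_nonneg _) (pow_le_one₀ (norm_nonneg _) hq.le)
  have hone : ∑' n : ℕ, qPoch a q n / qPoch q q n * (0 : ℂ) ^ n = 1 := by
    rw [tsum_eq_single 0 fun n hn => by simp [hn]]
    simp [qPoch_zero]
  rw [hone] at hlim
  have h₁ := (tendsto_qPoch z hq).mul_const (∑' n : ℕ, qPoch a q n / qPoch q q n * z ^ n)
  have h₂ := (tendsto_qPoch (a * z) hq).mul hlim
  rw [mul_one] at h₂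
  exact tendsto_nhds_unique h₁ (h₂.congr fun m => (hiter m).symm)

/-- Euler's expansion of `1 / (z; q)_∞`. -/
lemma tsum_pow_div_qPoch {q z : ℂ} (hq : ‖q‖ < 1) (hz : ‖z‖ < 1) :
    ∑' n : ℕ, z ^ n / qPoch q q n = (qPochInf z q)⁻¹ := by
  have h := qPochInf_mul_tsum_qBinomial (a := 0) (by simp) hq hz
  have h0 : qPochInf 0 q = 1 := by simp [qPochInf]
  have hp : ∀ n, qPoch 0 q n = 1 := by simp [qPoch]
  simp only [zero_mul, h0, hp, one_div_mul_eq_div] at h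
  exact eq_inv_of_mul_eq_one_right h

lemma qPochInf_mul_tsum_qBinomial_add {a q z : ℂ} (ha : ‖a‖ ≤ 1) (hq : ‖q‖ < 1) (hz : ‖z‖ < 1) :
    qPochInf z q * ∑' n : ℕ, qPoch a q n / qPoch q q n * z ^ n * (1 + a * z * q ^ n) =
      (1 - a * z ^ 2) * qPochInf (a * z * q) q := by
  have hzq : ‖z * q‖ < 1 := by simpa using norm_mul_pow_lt_one hz hq 1
  have h₁ := summable_qBinomial ha hq hz
  have h₂ := summable_qBinomial ha hq hzq
  have hsplit : ∑' n : ℕ, qPoch a q n / qPoch q q n * z ^ n * (1 + a * z * q ^ n) =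
      ∑' n : ℕ, qPoch a q n / qPoch q q n * z ^ n +
        a * z * ∑' n : ℕ, qPoch a q n / qPoch q q n * (z * q) ^ n := by
    rw [← tsum_mul_left, ← h₁.tsum_add (h₂.mul_left _)]
    exact tsum_congr fun n => by ring
  have e₁ := qPochInf_mul_tsum_qBinomial ha hq hz
  have e₂ := qPochInf_mul_tsum_qBinomial ha hq hzq
  rw [qPochInf_eq_one_sub_mul (a * z) hq] at e₁
  rw [← mul_assoc a] at e₂
  rw [hsplit]
  linear_combination e₁ + a * z * (1 - z) * e₂ + a * z *
    (∑' n : ℕ, qPoch a q n / qPoch q q n * (z * q) ^ n) * qPochInf_eq_one_sub_mul z hq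

/-- The summand of a quadratic very-well-poised type series. -/
noncomputable def quadraticTerm (q b X : ℂ) (i : ℕ) : ℂ :=
  X ^ i * q ^ i.choose 2 * qPoch (X * b) q i * qPoch b (q ^ 2) i *
    qPochInf (X ^ 2 * b * q ^ (2 * i + 2)) (q ^ 2) * (1 - X ^ 2 * b ^ 2 * q ^ (4 * i)) /
    qPoch q q i

/-- The antidifference that certifies the contiguous relation of `quadraticTerm`. -/
noncomputable def quadraticCertificate (q b X : ℂ) (i : ℕ) : ℂ :=
  -(X ^ i * q ^ i.choose 2 * qPoch (X * b) q i * qPoch b (q ^ 2) i *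
    qPochInf (X ^ 2 * b * q ^ (2 * i + 2)) (q ^ 2) * (1 - q ^ i) * (1 + X * b * q ^ (2 * i)) /
    qPoch q q i)

lemma quadraticTerm_sub (b X : ℂ) {q : ℂ} (hq : ‖q‖ < 1) (i : ℕ) :
    quadraticTerm q b X i - (1 - X * b) * (1 + X) * quadraticTerm q b (X * q) i =
      quadraticCertificate q b X (i + 1) - quadraticCertificate q b X i := by
  have hp := qPochInf_eq_one_sub_mul (X ^ 2 * b * q ^ (2 * i + 2)) (norm_sq_lt_one hq)
  have e₁ : X ^ 2 * b * q ^ (2 * i + 2) * q ^ 2 = X ^ 2 * b * q ^ (2 * i + 4) := by ring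
  have e₂ : (X * q) ^ 2 * b * q ^ (2 * i + 2) = X ^ 2 * b * q ^ (2 * i + 4) := by ring
  have e₃ : 2 * (i + 1) + 2 = 2 * i + 4 := by ring
  have hs : (1 - X * b) * qPoch (X * q * b) q i = qPoch (X * b) q i * (1 - X * b * q ^ i) := by
    rw [← qPoch_succ, qPoch_succ_left, mul_right_comm X q b]
  have hc : (i + 1).choose 2 = i + i.choose 2 := by
    rw [Nat.choose_succ_succ' i 1, Nat.choose_one_right]
  have hn := qPoch_ne_zero hq hq i
  have hn' : 1 - q * q ^ i ≠ 0 := one_sub_ne_zero_of_norm_lt_one (norm_mul_pow_lt_one hq hq i)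
  have ht : (1 - X * b) * (1 + X) * quadraticTerm q b (X * q) i =
      (1 + X) * ((X * q) ^ i * q ^ i.choose 2 * (qPoch (X * b) q i * (1 - X * b * q ^ i)) *
        qPoch b (q ^ 2) i * qPochInf (X ^ 2 * b * q ^ (2 * i + 4)) (q ^ 2) *
        (1 - (X * q) ^ 2 * b ^ 2 * q ^ (4 * i)) / qPoch q q i) := by
    rw [quadraticTerm, e₂, ← hs]
    ring
  rw [ht, quadraticTerm, quadraticCertificate, quadraticCertificate, hp, e₁, e₃, hc, qPoch_succ,
    qPoch_succ, qPoch_succ]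
  field_simp
  ring

lemma norm_mul_pow_le_one {a q : ℂ} (ha : ‖a‖ ≤ 1) (hq : ‖q‖ ≤ 1) (n : ℕ) : ‖a * q ^ n‖ ≤ 1 := by
  rw [norm_mul, norm_pow]
  exact mul_le_one₀ ha (by positivity) (pow_le_one₀ (norm_nonneg _) hq)

lemma exists_norm_quadratic_le {q : ℂ} (hq : ‖q‖ < 1) :
    ∃ M : ℝ, 0 ≤ M ∧ ∀ b X : ℂ, ‖b‖ ≤ 1 → ‖X‖ ≤ 1 → ∀ i,
      ‖qPoch (X * b) q i * qPoch b (q ^ 2) i *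
        qPochInf (X ^ 2 * b * q ^ (2 * i + 2)) (q ^ 2) / qPoch q q i‖ ≤ M := by
  obtain ⟨M₁, h₁, hM₁⟩ := exists_norm_qPoch_le hq
  obtain ⟨M₂, h₂, hM₂⟩ := exists_norm_qPoch_le (norm_sq_lt_one hq)
  obtain ⟨N, hN0, hN⟩ := exists_norm_inv_qPoch_le hq
  refine ⟨M₁ * M₂ * M₂ * N, by positivity, fun b X hb hX i => ?_⟩
  have hXb : ‖X * b‖ ≤ 1 := by rw [norm_mul]; exact mul_le_one₀ hX (norm_nonneg _) hb
  have hXXb : ‖X ^ 2 * b‖ ≤ 1 := by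
    rw [norm_mul, norm_pow]
    exact mul_le_one₀ (pow_le_one₀ (norm_nonneg _) hX) (norm_nonneg _) hb
  rw [div_eq_mul_inv, norm_mul, norm_mul, norm_mul]
  gcongr
  · exact (hM₁ _ hXb).1 i
  · exact (hM₂ _ hb).1 i
  · exact (hM₂ _ (norm_mul_pow_le_one hXXb hq.le _)).2
  · exact hN i

lemma exists_norm_quadraticTerm_le {q : ℂ} (hq : ‖q‖ < 1) :
    ∃ M : ℝ, 0 ≤ M ∧ ∀ b X : ℂ, ‖b‖ ≤ 1 → ‖X‖ ≤ 1 → ∀ i,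
      ‖quadraticTerm q b X i‖ ≤ M * ‖X‖ ^ i ∧ ‖quadraticCertificate q b X i‖ ≤ M * ‖X‖ ^ i := by
  obtain ⟨M, hM0, hM⟩ := exists_norm_quadratic_le hq
  refine ⟨M * 4, by positivity, fun b X hb hX i => ?_⟩
  have hXb : ‖X * b‖ ≤ 1 := by rw [norm_mul]; exact mul_le_one₀ hX (norm_nonneg _) hb
  have hXb2 : ‖(X * b) ^ 2‖ ≤ 1 := by rw [norm_pow]; exact pow_le_one₀ (norm_nonneg _) hXb
  have hsub : ∀ w : ℂ, ‖w‖ ≤ 1 → ‖1 - w‖ ≤ 2 := fun w hw =>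
    (norm_sub_le _ _).trans (by rw [norm_one]; linarith)
  have hadd : ∀ w : ℂ, ‖w‖ ≤ 1 → ‖1 + w‖ ≤ 2 := fun w hw =>
    (norm_add_le _ _).trans (by rw [norm_one]; linarith)
  have hqi : ∀ n, ‖q ^ n‖ ≤ 1 := fun n => by
    rw [norm_pow]; exact pow_le_one₀ (norm_nonneg _) hq.le
  have hbound : ∀ w : ℂ, ‖w‖ ≤ 4 →
      ‖qPoch (X * b) q i * qPoch b (q ^ 2) i *
        qPochInf (X ^ 2 * b * q ^ (2 * i + 2)) (q ^ 2) / qPoch q q i * w * q ^ i.choose 2 *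
        X ^ i‖ ≤ M * 4 * ‖X‖ ^ i := fun w hw => by
    rw [norm_mul, norm_pow X, norm_mul, norm_mul _ w]
    refine mul_le_mul_of_nonneg_right ?_ (by positivity)
    exact (mul_le_of_le_one_right (by positivity) (hqi _)).trans
      (mul_le_mul (hM b X hb hX i) hw (norm_nonneg _) hM0)
  constructor
  · have h := hbound (1 - (X * b) ^ 2 * q ^ (4 * i))
      ((hsub _ (norm_mul_pow_le_one hXb2 hq.le _)).trans (by norm_num))
    rw [quadraticTerm]
    refine (congrArg norm ?_).trans_le h
    ring
  · have h := hbound ((1 - q ^ i) * (1 + X * b * q ^ (2 * i))) (by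
      rw [norm_mul]
      calc _ ≤ (2 : ℝ) * 2 := mul_le_mul (hsub _ (hqi i))
            (hadd _ (norm_mul_pow_le_one hXb hq.le _)) (norm_nonneg _) (by norm_num)
        _ = 4 := by norm_num)
    rw [quadraticCertificate, norm_neg]
    refine (congrArg norm ?_).trans_le h
    ring

lemma summable_quadraticTerm {q b X : ℂ} (hq : ‖q‖ < 1) (hb : ‖b‖ ≤ 1) (hX : ‖X‖ < 1) :
    Summable (quadraticTerm q b X) := by
  obtain ⟨M, _, hM⟩ := exists_norm_quadraticTerm_le hq
  exact .of_norm_bounded ((summable_geometric_of_lt_one (norm_nonneg X) hX).mul_left M)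
    fun i => (hM b X hb hX.le i).1

lemma tsum_quadraticTerm_step {q b X : ℂ} (hq : ‖q‖ < 1) (hb : ‖b‖ ≤ 1) (hX : ‖X‖ < 1) :
    ∑' i, quadraticTerm q b X i =
      (1 - X * b) * (1 + X) * ∑' i, quadraticTerm q b (X * q) i := by
  have hXq : ‖X * q‖ < 1 := by simpa using norm_mul_pow_lt_one hX hq 1
  obtain ⟨M, _, hM⟩ := exists_norm_quadraticTerm_le hq
  have hsum := (summable_quadraticTerm hq hb hX).hasSum.sub
    ((summable_quadraticTerm hq hb hXq).hasSum.mul_left ((1 - X * b) * (1 + X)))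
  have hG : Tendsto (quadraticCertificate q b X) atTop (𝓝 0) := by
    refine squeeze_zero_norm (fun i => (hM b X hb hX.le i).2) ?_
    simpa using (tendsto_pow_atTop_nhds_zero_of_lt_one (norm_nonneg X) hX).const_mul M
  have hG0 : quadraticCertificate q b X 0 = 0 := by simp [quadraticCertificate]
  have h := hsum.tendsto_sum_nat
  simp only [quadraticTerm_sub b X hq, Finset.sum_range_sub, hG0, sub_zero] at h
  exact sub_eq_zero.mp (tendsto_nhds_unique h hG)

lemma tendsto_quadraticTerm {q b : ℂ} (hq : ‖q‖ < 1) (i : ℕ) :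
    Tendsto (fun X => quadraticTerm q b X i) (𝓝 0) (𝓝 (if i = 0 then 1 else 0)) := by
  have hinf : Tendsto (fun X : ℂ => qPochInf (X ^ 2 * b * q ^ (2 * i + 2)) (q ^ 2)) (𝓝 0)
      (𝓝 1) := by
    refine (tendsto_qPochInf_zero (norm_sq_lt_one hq)).comp ?_
    have : Continuous fun X : ℂ => X ^ 2 * b * q ^ (2 * i + 2) := by fun_prop
    simpa using this.tendsto 0
  have h₁ : Continuous fun X : ℂ =>
      X ^ i * q ^ i.choose 2 * qPoch (X * b) q i * qPoch b (q ^ 2) i := by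
    unfold qPoch; fun_prop
  have h₂ : Continuous fun X : ℂ => 1 - X ^ 2 * b ^ 2 * q ^ (4 * i) := by fun_prop
  have h := (((h₁.tendsto 0).mul hinf).mul (h₂.tendsto 0)).div_const (qPoch q q i)
  have hval : (if i = 0 then 1 else 0) = 0 ^ i * q ^ i.choose 2 * qPoch (0 * b) q i *
      qPoch b (q ^ 2) i * 1 * (1 - 0 ^ 2 * b ^ 2 * q ^ (4 * i)) / qPoch q q i := by
    rcases eq_or_ne i 0 with rfl | hi
    · simp [qPoch_zero]
    · simp [hi]
  rw [hval]
  exact h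

/-- A quadratic summation formula. -/
theorem tsum_quadraticTerm {q b X : ℂ} (hq : ‖q‖ < 1) (hb : ‖b‖ ≤ 1) (hX : ‖X‖ < 1) :
    ∑' i, quadraticTerm q b X i = qPochInf (X * b) q * qPochInf (-X) q := by
  have hiter : ∀ m : ℕ, ∑' i, quadraticTerm q b X i =
      qPoch (X * b) q m * qPoch (-X) q m * ∑' i, quadraticTerm q b (X * q ^ m) i := by
    intro m
    induction m with
    | zero => simp [qPoch_zero]
    | succ m ih =>
      rw [ih, tsum_quadraticTerm_step hq hb (norm_mul_pow_lt_one hX hq m), qPoch_succ, qPoch_succ,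
        mul_assoc X _ q, ← pow_succ]
      ring
  have h0 : Tendsto (fun m : ℕ => X * q ^ m) atTop (𝓝 0) := by
    simpa using (tendsto_pow_atTop_nhds_zero_of_norm_lt_one hq).const_mul X
  have hlim : Tendsto (fun m : ℕ => ∑' i, quadraticTerm q b (X * q ^ m) i) atTop
      (𝓝 (∑' i : ℕ, if i = 0 then 1 else 0)) := by
    obtain ⟨M, hM0, hM⟩ := exists_norm_quadraticTerm_le hq
    refine tendsto_tsum_of_dominated_convergence
      ((summable_geometric_of_lt_one (norm_nonneg X) hX).mul_left M)
      (fun i => (tendsto_quadraticTerm hq i).comp h0) (Eventually.of_forall fun m i => ?_)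
    refine (hM b _ hb (norm_mul_pow_lt_one hX hq m).le i).1.trans ?_
    gcongr
    rw [norm_mul, norm_pow]
    exact mul_le_of_le_one_right (norm_nonneg _) (pow_le_one₀ (norm_nonneg _) hq.le)
  rw [tsum_ite_eq] at hlim
  have h := ((tendsto_qPoch (X * b) hq).mul (tendsto_qPoch (-X) hq)).mul hlim
  rw [mul_one] at h
  exact tendsto_nhds_unique (tendsto_const_nhds.congr hiter) h

/-- The summand of the quadruple series. -/
noncomputable def quadrupleTerm (q x y : ℂ) (n : ℕ × ℕ × ℕ × ℕ) : ℂ :=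
  x ^ (n.1 + n.2.1 + 2 * n.2.2.2) * y ^ (n.2.1 + n.2.2.1) *
    q ^ (2 * Nat.choose n.1 2 + 2 * n.1 * n.2.1 + 4 * n.1 * n.2.2.1 +
      4 * n.2.2.1 * n.2.2.2 + n.1 + 3 * n.2.1 + 2 * n.2.2.1 + 2 * n.2.2.2) *
    (1 + x ^ 2 * y * q ^ (4 + 4 * (n.1 + n.2.2.1))) /
    (qPoch (q ^ 2) (q ^ 2) n.1 * qPoch (q ^ 2) (q ^ 2) n.2.1 *
      qPoch (q ^ 4) (q ^ 4) n.2.2.1 * qPoch (q ^ 4) (q ^ 4) n.2.2.2)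

lemma summable_quadrupleTerm {q x y : ℂ} (hq : ‖q‖ < 1) (hx : ‖x‖ ≤ 1) (hy : ‖y‖ ≤ 1) :
    Summable (quadrupleTerm q x y) := by
  obtain ⟨M, hM0, hM⟩ := exists_norm_inv_qPoch_le (norm_sq_lt_one hq)
  obtain ⟨N, hN0, hN⟩ := exists_norm_inv_qPoch_le (norm_pow_four_lt_one hq)
  have hg := summable_geometric_of_lt_one (norm_nonneg q) hq
  have hg0 : (0 : ℕ → ℝ) ≤ fun n => ‖q‖ ^ n := fun n => by positivity
  have hg₂ := hg.mul_of_nonneg hg hg0 hg0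
  have hg₃ := hg.mul_of_nonneg hg₂ hg0 fun n => by positivity
  have hg₄ := hg.mul_of_nonneg hg₃ hg0 fun n => by positivity
  refine .of_norm_bounded (hg₄.mul_left (2 * (M * M * N * N))) fun ⟨a, b, c, d⟩ => ?_
  have hxy : ‖x ^ 2 * y‖ ≤ 1 := by
    rw [norm_mul, norm_pow]
    exact mul_le_one₀ (pow_le_one₀ (norm_nonneg _) hx) (norm_nonneg _) hy
  have hlin : ‖1 + x ^ 2 * y * q ^ (4 + 4 * (a + c))‖ ≤ 2 := by
    refine (norm_add_le _ _).trans ?_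
    have := norm_mul_pow_le_one hxy hq.le (4 + 4 * (a + c))
    rw [norm_one]
    linarith
  have hmon : ‖x ^ (a + b + 2 * d) * y ^ (b + c)‖ ≤ 1 := by
    rw [norm_mul, norm_pow, norm_pow]
    exact mul_le_one₀ (pow_le_one₀ (norm_nonneg _) hx) (by positivity)
      (pow_le_one₀ (norm_nonneg _) hy)
  have hpow : ‖q ^ (2 * Nat.choose a 2 + 2 * a * b + 4 * a * c + 4 * c * d + a + 3 * b + 2 * c +
      2 * d)‖ ≤ ‖q‖ ^ (a + (b + (c + d))) := by
    rw [norm_pow]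
    exact pow_le_pow_of_le_one (norm_nonneg _) hq.le (by lia)
  have hinv : ‖(qPoch (q ^ 2) (q ^ 2) a)⁻¹ * (qPoch (q ^ 2) (q ^ 2) b)⁻¹ *
      (qPoch (q ^ 4) (q ^ 4) c)⁻¹ * (qPoch (q ^ 4) (q ^ 4) d)⁻¹‖ ≤ M * M * N * N := by
    simp only [norm_mul]
    gcongr
    · exact hM a
    · exact hM b
    · exact hN c
    · exact hN d
  calc ‖quadrupleTerm q x y (a, b, c, d)‖ = _ := by
        rw [quadrupleTerm, div_eq_mul_inv, mul_inv, mul_inv, mul_inv, norm_mul, norm_mul, norm_mul]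
    _ ≤ 1 * ‖q‖ ^ (a + (b + (c + d))) * 2 * (M * M * N * N) := by gcongr
    _ = _ := by simp only [pow_add]; ring

lemma tsum_prod_four {f : ℕ × ℕ × ℕ × ℕ → ℂ} (hf : Summable f) :
    ∑' n, f n = ∑' (a) (b) (c) (d), f (a, b, c, d) := by
  rw [hf.tsum_prod]
  refine tsum_congr fun a => ?_
  rw [(hf.prod_factor a).tsum_prod]
  exact tsum_congr fun b => ((hf.prod_factor a).prod_factor b).tsum_prod

lemma inv_qPochInf_mul_pow {a q : ℂ} (ha : ‖a‖ < 1) (hq : ‖q‖ < 1) (n : ℕ) :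
    (qPochInf (a * q ^ n) q)⁻¹ = qPoch a q n * (qPochInf a q)⁻¹ := by
  have h := qPoch_ne_zero ha hq n
  rw [← qPoch_mul_qPochInf a hq n, mul_inv, mul_inv_cancel_left₀ h]

lemma tsum_quadrupleTerm_fourth {q x y : ℂ} (hq : ‖q‖ < 1) (hx : ‖x‖ ≤ 1) (a b c : ℕ) :
    ∑' d, quadrupleTerm q x y (a, b, c, d) =
      x ^ (a + b) * y ^ b * q ^ (2 * a.choose 2 + 2 * a * b + a + 3 * b) /
        (qPoch (q ^ 2) (q ^ 2) a * qPoch (q ^ 2) (q ^ 2) b) * (qPochInf (x ^ 2 * q ^ 2) (q ^ 4))⁻¹ *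
      (qPoch (x ^ 2 * q ^ 2) (q ^ 4) c / qPoch (q ^ 4) (q ^ 4) c * (y * q ^ (2 + 4 * a)) ^ c *
        (1 + x ^ 2 * q ^ 2 * (y * q ^ (2 + 4 * a)) * (q ^ 4) ^ c)) := by
  have hq4 := norm_pow_four_lt_one hq
  have hxq : ‖x ^ 2 * q ^ 2‖ < 1 := by
    rw [← mul_pow, norm_pow, norm_mul]
    exact pow_lt_one₀ (by positivity) (mul_lt_one_of_nonneg_of_lt_one_right hx (norm_nonneg _) hq)
      two_ne_zero
  have h := tsum_pow_div_qPoch hq4 (norm_mul_pow_lt_one hxq hq4 c)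
  rw [inv_qPochInf_mul_pow hxq hq4] at h
  calc _ = ∑' d, x ^ (a + b) * y ^ b * q ^ (2 * a.choose 2 + 2 * a * b + a + 3 * b) /
        (qPoch (q ^ 2) (q ^ 2) a * qPoch (q ^ 2) (q ^ 2) b) *
        ((y * q ^ (2 + 4 * a)) ^ c / qPoch (q ^ 4) (q ^ 4) c *
        (1 + x ^ 2 * q ^ 2 * (y * q ^ (2 + 4 * a)) * (q ^ 4) ^ c)) *
        ((x ^ 2 * q ^ 2 * (q ^ 4) ^ c) ^ d / qPoch (q ^ 4) (q ^ 4) d) :=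
        tsum_congr fun d => by rw [quadrupleTerm]; ring
    _ = _ := by rw [tsum_mul_left, h]; ring

lemma tsum_quadrupleTerm_third {q x y : ℂ} (hq : ‖q‖ < 1) (hx : ‖x‖ ≤ 1) (hy : ‖y‖ ≤ 1)
    (a b : ℕ) :
    ∑' (c) (d), quadrupleTerm q x y (a, b, c, d) =
      x ^ a * q ^ (2 * a.choose 2 + a) / qPoch (q ^ 2) (q ^ 2) a *
        ((qPochInf (x ^ 2 * q ^ 2) (q ^ 4))⁻¹ * (qPochInf (y * q ^ 2) (q ^ 4))⁻¹) *
        (qPoch (y * q ^ 2) (q ^ 4) a * (1 - x ^ 2 * y ^ 2 * q ^ (6 + 8 * a)) *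
          qPochInf (x ^ 2 * y * q ^ (8 + 4 * a)) (q ^ 4)) *
      ((x * y * q ^ 3 * (q ^ 2) ^ a) ^ b / qPoch (q ^ 2) (q ^ 2) b) := by
  have hq4 := norm_pow_four_lt_one hq
  have hxq : ‖x ^ 2 * q ^ 2‖ ≤ 1 := by
    refine norm_mul_pow_le_one ?_ hq.le 2
    rw [norm_pow]
    exact pow_le_one₀ (norm_nonneg _) hx
  have hyq : ‖y * q ^ 2‖ < 1 := by
    rw [norm_mul]
    exact mul_lt_one_of_nonneg_of_lt_one_right hy (norm_nonneg _) (norm_sq_lt_one hq)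
  have hs : y * q ^ (2 + 4 * a) = y * q ^ 2 * (q ^ 4) ^ a := by ring
  have hyqa : ‖y * q ^ (2 + 4 * a)‖ < 1 := hs ▸ norm_mul_pow_lt_one hyq hq4 a
  have h := qPochInf_mul_tsum_qBinomial_add hxq hq4 hyqa
  rw [← eq_inv_mul_iff_mul_eq₀ (qPochInf_ne_zero hyqa hq4)] at h
  have hinv := inv_qPochInf_mul_pow hyq hq4 a
  rw [← hs] at hinv
  have harg : x ^ 2 * q ^ 2 * (y * q ^ (2 + 4 * a)) * q ^ 4 = x ^ 2 * y * q ^ (8 + 4 * a) := by ring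
  rw [hinv, harg] at h
  simp only [tsum_quadrupleTerm_fourth hq hx]
  rw [tsum_mul_left, h]
  ring

lemma tsum_quadrupleTerm_second {q x y : ℂ} (hq : ‖q‖ < 1) (hx : ‖x‖ ≤ 1) (hy : ‖y‖ ≤ 1)
    (a : ℕ) :
    ∑' (b) (c) (d), quadrupleTerm q x y (a, b, c, d) =
      (qPochInf (x ^ 2 * q ^ 2) (q ^ 4))⁻¹ * (qPochInf (y * q ^ 2) (q ^ 4))⁻¹ *
        (qPochInf (x * y * q ^ 3) (q ^ 2))⁻¹ * quadraticTerm (q ^ 2) (y * q ^ 2) (x * q) a := by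
  have hq2 := norm_sq_lt_one hq
  have hxyq : ‖x * y * q ^ 3‖ < 1 := by
    rw [norm_mul, norm_mul, norm_pow]
    exact mul_lt_one_of_nonneg_of_lt_one_right (mul_le_one₀ hx (norm_nonneg _) hy) (by positivity)
      (pow_lt_one₀ (norm_nonneg _) hq three_ne_zero)
  have h := tsum_pow_div_qPoch hq2 (norm_mul_pow_lt_one hxyq hq2 a)
  rw [inv_qPochInf_mul_pow hxyq hq2] at h
  have e₁ : x * q * (y * q ^ 2) = x * y * q ^ 3 := by ring
  have e₂ : (x * q) ^ 2 * (y * q ^ 2) * (q ^ 2) ^ (2 * a + 2) = x ^ 2 * y * q ^ (8 + 4 * a) := by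
    ring
  have e₃ : (q ^ 2) ^ 2 = q ^ 4 := by ring
  simp only [tsum_quadrupleTerm_third hq hx hy]
  rw [tsum_mul_left, h, quadraticTerm, e₁, e₂, e₃]
  ring

theorem tsum_quadrupleTerm {q x y : ℂ} (hq : ‖q‖ < 1) (hx : ‖x‖ ≤ 1) (hy : ‖y‖ ≤ 1) :
    1 / (qPochInf (x * q) (q ^ 2) * qPochInf (y * q ^ 2) (q ^ 4)) =
      ∑' n, quadrupleTerm q x y n := by
  have hq2 := norm_sq_lt_one hq
  have hxq : ‖x * q‖ < 1 := by
    rw [norm_mul]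
    exact mul_lt_one_of_nonneg_of_lt_one_right hx (norm_nonneg _) hq
  have hyq : ‖y * q ^ 2‖ < 1 := by
    rw [norm_mul]
    exact mul_lt_one_of_nonneg_of_lt_one_right hy (norm_nonneg _) hq2
  have hxyq : ‖x * q * (y * q ^ 2)‖ < 1 := by
    rw [norm_mul]
    exact mul_lt_one_of_nonneg_of_lt_one_right hxq.le (norm_nonneg _) hyq
  have e₁ : x * y * q ^ 3 = x * q * (y * q ^ 2) := by ring
  have hsq := qPochInf_sq (x * q) hq2
  rw [mul_pow, ← pow_mul] at hsq
  rw [tsum_prod_four (summable_quadrupleTerm hq hx hy)]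
  simp only [tsum_quadrupleTerm_second hq hx hy]
  rw [tsum_mul_left, tsum_quadraticTerm hq2 hyq.le hxq, hsq, e₁]
  have h₁ := qPochInf_ne_zero (a := -(x * q)) (by rwa [norm_neg]) hq2
  have h₂ := qPochInf_ne_zero hxyq hq2
  generalize qPochInf (-(x * q)) (q ^ 2) = u at *
  generalize qPochInf (x * q * (y * q ^ 2)) (q ^ 2) = v at *
  simp only [one_div, mul_inv]
  field_simp

/-- **Theorem 3.1**: an equivalent form of the quadruple-sum identity,
`1/((xq;q²)_∞ (yq²;q⁴)_∞)` written as a quadruple Andrews–Gordon type series. -/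
theorem quadruple_identity_reciprocal (q x y : ℂ) (hq : ‖q‖ < 1)
    (hx : ‖x‖ ≤ 1) (hy : ‖y‖ ≤ 1) :
    Summable (fun n : ℕ × ℕ × ℕ × ℕ =>
      x ^ (n.1 + n.2.1 + 2 * n.2.2.2) * y ^ (n.2.1 + n.2.2.1) *
        q ^ (2 * Nat.choose n.1 2 + 2 * n.1 * n.2.1 + 4 * n.1 * n.2.2.1 +
          4 * n.2.2.1 * n.2.2.2 + n.1 + 3 * n.2.1 + 2 * n.2.2.1 + 2 * n.2.2.2) *
        (1 + x ^ 2 * y * q ^ (4 + 4 * (n.1 + n.2.2.1))) /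
        (qPoch (q ^ 2) (q ^ 2) n.1 * qPoch (q ^ 2) (q ^ 2) n.2.1 *
          qPoch (q ^ 4) (q ^ 4) n.2.2.1 * qPoch (q ^ 4) (q ^ 4) n.2.2.2)) ∧
    1 / (qPochInf (x * q) (q ^ 2) * qPochInf (y * q ^ 2) (q ^ 4)) =
      ∑' n : ℕ × ℕ × ℕ × ℕ,
        x ^ (n.1 + n.2.1 + 2 * n.2.2.2) * y ^ (n.2.1 + n.2.2.1) *
          q ^ (2 * Nat.choose n.1 2 + 2 * n.1 * n.2.1 + 4 * n.1 * n.2.2.1 +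
            4 * n.2.2.1 * n.2.2.2 + n.1 + 3 * n.2.1 + 2 * n.2.2.1 + 2 * n.2.2.2) *
          (1 + x ^ 2 * y * q ^ (4 + 4 * (n.1 + n.2.2.1))) /
          (qPoch (q ^ 2) (q ^ 2) n.1 * qPoch (q ^ 2) (q ^ 2) n.2.1 *
            qPoch (q ^ 4) (q ^ 4) n.2.2.1 * qPoch (q ^ 4) (q ^ 4) n.2.2.2) := by
  exact ⟨summable_quadrupleTerm hq hx hy, tsum_quadrupleTerm hq hx hy⟩
end

section
/- For nonnegative integers n, m, let A₂(n,m) be the number of overpartitions λ = (P,O) in 𝒜_{1̄}^⋁ with |λ| = n and |P| + 2|O| + #{p ∈ P : p even} = m (i.e., parts counted with overlined parts given weight 3 and even parts given weight 2). Let B₂(n,m) be the number of multisets of odd positive integers in which every value has multiplicity at most 3, with exactly m elements counted with multiplicity and total sum n. Then A₂(n,m) = B₂(n,m). -/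
/-- Membership in the set `𝒜_{1̄}^⋁`: an overpartition is a pair `(P, O)` with `P` a finite
set of positive integers (the parts) and `O ⊆ {p ∈ P : p odd, p > 1}` (the overlined parts),
such that any two parts `a > b` differ by at least 4 — strictly more than 4 if `a` is
overlined or divisible by 4 — except that `5̄` and `1` may appear simultaneously. -/
def MemAVee (P O : Finset ℕ) : Prop :=
  (∀ p ∈ P, 0 < p) ∧ O ⊆ P ∧ (∀ p ∈ O, Odd p ∧ 1 < p) ∧
    ∀ a ∈ P, ∀ b ∈ P, b < a → ¬(a = 5 ∧ a ∈ O ∧ b = 1) →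
      4 ≤ a - b ∧ ((a ∈ O ∨ 4 ∣ a) → 5 ≤ a - b)

/-- `A₂(n,m)`: number of overpartitions `λ = (P,O) ∈ 𝒜_{1̄}^⋁` of `n` into `m` parts,
with overlined parts counted with weight 3 and even parts counted with weight 2. -/
noncomputable def A2count (n m : ℕ) : ℕ :=
  Set.ncard {lam : Finset ℕ × Finset ℕ | MemAVee lam.1 lam.2 ∧
    lam.1.sum id = n ∧
    lam.1.card + 2 * lam.2.card + (lam.1.filter fun p => Even p).card = m}

/-- `B₂(n,m)`: number of multisets of odd positive integers in which every value has
multiplicity at most 3, with `m` elements counted with multiplicity and total sum `n`. -/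
noncomputable def B2count (n m : ℕ) : ℕ :=
  Set.ncard {M : Multiset ℕ | (∀ p ∈ M, Odd p ∧ 0 < p) ∧ (∀ p, M.count p ≤ 3) ∧
    Multiset.card M = m ∧ M.sum = n}

/-- The recurrences satisfied by the generating polynomials of `𝒜_{1̄}^⋁` with bounded largest
part. The sequences `a, b, c, d, e` stand for the bounds
`4k - 1, 4k, 4k + 1, 4k + 2, 4k - 2`; the initial value of `b` is the one for which the recurrence of `c` also covers the parts `5̄` and `1`
appearing simultaneously. -/
structure IsBoundedChain {R : Type*} [CommRing R] (q z : R) (a b c d e : ℕ → R) : Prop where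
  a_zero : a 0 = 1
  b_zero : b 0 = 1 + z * q
  c_zero : c 0 = 1 + z * q
  e_zero : e 0 = 1
  a_succ : ∀ k, a (k + 1) = d k + z * q ^ (4 * k + 3) * a k + z ^ 3 * q ^ (4 * k + 3) * e k
  b_succ : ∀ k, b (k + 1) = a (k + 1) + z ^ 2 * q ^ (4 * k + 4) * a k
  c_succ : ∀ k, c (k + 1) = b (k + 1) + z * q ^ (4 * k + 5) * c k + z ^ 3 * q ^ (4 * k + 5) * b k
  d_eq : ∀ k, d k = c k + z ^ 2 * q ^ (4 * k + 2) * e k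
  e_succ : ∀ k, e (k + 1) = d k

namespace IsBoundedChain

variable {R : Type*} [CommRing R] {q z : R} {a b c d e A B C D E : ℕ → R}

theorem b_succ_eq (h : IsBoundedChain q z a b c d e) (k : ℕ) :
    b (k + 1) = (1 + z * q) * a (k + 1) - (z * q + z ^ 2 * q ^ 2) * d k + z ^ 2 * q ^ 2 * c k := by
  linear_combination h.b_succ k - z * q * h.a_succ k + z ^ 2 * q ^ 2 * h.d_eq k

/-- The effect of the substitution `z ↦ z q²` on the bounded generating polynomials. -/
theorem shift_eq (h : IsBoundedChain q z a b c d e)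
    (H : IsBoundedChain q (z * q ^ 2) A B C D E) (k : ℕ) :
    (1 + z * q) * (1 + z ^ 2 * q ^ 2) * B k =
        (q ^ (4 * k) * (z * q ^ 3 + z ^ 2 * q ^ 4)
          - (q ^ (4 * k)) ^ 2 * (q ^ 2 + z * q ^ 3)) * a k
        + (q ^ (4 * k) * (z ^ 3 * q ^ 5) + (q ^ (4 * k)) ^ 2 * q ^ 2) * b k
        + (1 - q ^ (4 * k) * (z * q ^ 3)) * c k
        + (q ^ (4 * k) * (z ^ 2 * q ^ 2 + z ^ 3 * q ^ 3)
          + (q ^ (4 * k)) ^ 2 * (z * q ^ 3 + z ^ 2 * q ^ 4)) * e k ∧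
      (1 + z * q) * (1 + z ^ 2 * q ^ 2) * C k =
        (q ^ (4 * k) * (z * q ^ 3 + z ^ 2 * q ^ 4)
          + (q ^ (4 * k)) ^ 2 * (z ^ 2 * q ^ 6 + z ^ 3 * q ^ 7)) * a k
        + (q ^ (4 * k) * (z ^ 3 * q ^ 5) - (q ^ (4 * k)) ^ 2 * (z ^ 2 * q ^ 6)) * b k
        + (1 + q ^ (4 * k) * (z ^ 3 * q ^ 7)) * c k
        + (q ^ (4 * k) * (z ^ 2 * q ^ 2 + z ^ 3 * q ^ 3)
          - (q ^ (4 * k)) ^ 2 * (z ^ 3 * q ^ 7 + z ^ 4 * q ^ 8)) * e k ∧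
      (1 + z * q) * (1 + z ^ 2 * q ^ 2) * D k =
        q ^ (4 * k) * (z * q ^ 3 + z ^ 2 * q ^ 4) * a k
        + q ^ (4 * k) * (z ^ 3 * q ^ 5) * b k
        + (-(z * q) + q ^ (4 * k) * (z * q ^ 5 + z ^ 2 * q ^ 6)) * c k
        + (1 + z * q + q ^ (4 * k) * (z ^ 3 * q ^ 7 - z * q ^ 5)) * d k ∧
      (1 + z * q) * (1 + z ^ 2 * q ^ 2) * A (k + 1) =
        q ^ (4 * k) * (z ^ 3 * q ^ 5) * b k
        + (z ^ 2 * q ^ 2 + q ^ (4 * k) * (z * q ^ 5 - z ^ 4 * q ^ 10)) * c k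
        + (-(z * q) - z ^ 2 * q ^ 2
          + q ^ (4 * k) * ((1 + z * q) * (z ^ 2 * q ^ 6 + z ^ 3 * q ^ 9))) * d k
        + (1 + z * q) * a (k + 1) := by
  induction k with
  | zero =>
    simp only [H.a_succ, H.d_eq, H.a_zero, H.b_zero, H.c_zero, H.e_zero, h.a_succ, h.d_eq,
      h.a_zero, h.b_zero, h.c_zero, h.e_zero]
    refine ⟨?_, ?_, ?_, ?_⟩ <;> ring
  | succ k ih =>
    obtain ⟨hB, hC, hD, hA⟩ := ih
    have hd := h.d_eq k
    have ha := h.a_succ k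
    have hb := h.b_succ k
    have hc := h.c_succ k
    have he := h.e_succ k
    have hd' := h.d_eq (k + 1)
    have ha' := h.a_succ (k + 1)
    have HB := H.b_succ_eq k
    have HC := H.c_succ k
    have HD := H.d_eq (k + 1)
    have HA := H.a_succ (k + 1)
    have HE := H.e_succ k
    rw [HE] at HD HA
    have key : ∀ n, q ^ (4 * k + n) = q ^ (4 * k) * q ^ n := fun n => pow_add _ _ _
    have key' : ∀ n, q ^ (4 * (k + 1) + n) = q ^ (4 * k) * q ^ (n + 4) := fun n => by ring
    have key0 : q ^ (4 * (k + 1)) = q ^ (4 * k) * q ^ 4 := by ring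
    simp only [key, key', key0] at *
    generalize q ^ (4 * k) = Q at *
    generalize (1 + z * q) * (1 + z ^ 2 * q ^ 2) = P at *
    have gB : P * B (k + 1) = (1 + z * q ^ 2 * q) * (P * A (k + 1))
        - (z * q ^ 2 * q + (z * q ^ 2) ^ 2 * q ^ 2) * (P * D k)
        + (z * q ^ 2) ^ 2 * q ^ 2 * (P * C k) := by rw [HB]; ring
    have gC : P * C (k + 1) = P * B (k + 1) + z * q ^ 2 * (Q * q ^ 5) * (P * C k)
        + (z * q ^ 2) ^ 3 * (Q * q ^ 5) * (P * B k) := by rw [HC]; ring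
    have gD : P * D (k + 1) = P * C (k + 1) + (z * q ^ 2) ^ 2 * (Q * q ^ 6) * (P * D k) := by
      rw [HD]; ring
    have gA : P * A (k + 1 + 1) = P * D (k + 1) + z * q ^ 2 * (Q * q ^ 7) * (P * A (k + 1))
        + (z * q ^ 2) ^ 3 * (Q * q ^ 7) * (P * D k) := by rw [HA]; ring
    rw [hA, hD, hC] at gB
    rw [gB, hC, hB] at gC
    rw [gC, hD] at gD
    rw [gD, hA, hD] at gA
    rw [gB, gC, gD, gA]
    rw [ha', hd', hc, hb, he, ha, hd]
    refine ⟨?_, ?_, ?_, ?_⟩ <;> ring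

theorem pow_dvd_shift_sub (h : IsBoundedChain q z a b c d e)
    (H : IsBoundedChain q (z * q ^ 2) A B C D E) (k : ℕ) :
    q ^ (4 * k) ∣ (1 + z * q) * (1 + z ^ 2 * q ^ 2) * D k - d k := by
  refine ⟨(z * q ^ 3 + z ^ 2 * q ^ 4) * a k + z ^ 3 * q ^ 5 * b k
    + (z * q ^ 5 + z ^ 2 * q ^ 6) * c k + (z ^ 3 * q ^ 7 - z * q ^ 5) * d k
    + z ^ 3 * q ^ 3 * e k, ?_⟩
  linear_combination (h.shift_eq H k).2.2.1 + z * q * h.d_eq k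

end IsBoundedChain

section Bounded

open Finset Classical

/-- The number of parts, with overlined parts counted with weight 3 and even parts with
weight 2. -/
def overWeight (lam : Finset ℕ × Finset ℕ) : ℕ :=
  lam.1.card + 2 * lam.2.card + (lam.1.filter fun p => Even p).card

/-- The overpartitions in `𝒜_{1̄}^⋁` all of whose parts are at most `N`. -/
noncomputable def boundedAVee (N : ℕ) : Finset (Finset ℕ × Finset ℕ) :=
  ((Icc 1 N).powerset ×ˢ (Icc 1 N).powerset).filter fun lam => MemAVee lam.1 lam.2

theorem mem_boundedAVee {N : ℕ} {lam : Finset ℕ × Finset ℕ} :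
    lam ∈ boundedAVee N ↔ MemAVee lam.1 lam.2 ∧ ∀ p ∈ lam.1, p ≤ N := by
  simp only [boundedAVee, mem_filter, mem_product, mem_powerset, subset_iff, mem_Icc]
  constructor
  · rintro ⟨⟨h1, -⟩, h⟩
    exact ⟨h, fun p hp => (h1 hp).2⟩
  · rintro ⟨h, hN⟩
    exact ⟨⟨fun p hp => ⟨h.1 p hp, hN p hp⟩,
      fun p hp => ⟨h.1 p (h.2.1 hp), hN p (h.2.1 hp)⟩⟩, h⟩

/-- The generating polynomial of `boundedAVee N` by weight and size. -/
noncomputable def boundedGF {R : Type*} [CommRing R] (q z : R) (N : ℕ) : R :=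
  ∑ lam ∈ boundedAVee N, z ^ overWeight lam * q ^ lam.1.sum id

variable {R : Type*} [CommRing R] (q z : R)

theorem boundedGF_zero : boundedGF q z 0 = 1 := by
  have : boundedAVee 0 = {(∅, ∅)} := by
    ext ⟨P, O⟩
    simp only [boundedAVee, mem_filter, mem_product, mem_powerset, mem_singleton, Prod.mk.injEq]
    constructor
    · rintro ⟨⟨h1, h2⟩, -⟩
      exact ⟨by simpa using h1, by simpa using h2⟩
    · rintro ⟨rfl, rfl⟩
      simp [MemAVee]
  simp [boundedGF, this, overWeight]

/-- Adjoining the part `N`, overlined if `t` holds, to an overpartition with parts at most `M`,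
where `M` bounds the smaller parts that are compatible with `N`. -/
theorem sum_filter_mem_boundedAVee {N M : ℕ} (t : Bool) (hN : 0 < N) (hM : M < N)
    (ht : t → Odd N ∧ 1 < N)
    (hb : ∀ b, 0 < b → b < N → (b ≤ M ↔ (¬(N = 5 ∧ t ∧ b = 1) →
      4 ≤ N - b ∧ ((t ∨ 4 ∣ N) → 5 ≤ N - b)))) :
    ∑ lam ∈ (boundedAVee N).filter (fun lam => N ∈ lam.1 ∧ (N ∈ lam.2 ↔ t)),
        z ^ overWeight lam * q ^ lam.1.sum id =
      z ^ (1 + (if t then 2 else 0) + if Even N then 1 else 0) * q ^ N * boundedGF q z M := by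
  rw [boundedGF, mul_sum]
  refine sum_nbij' (fun lam => (lam.1.erase N, lam.2.erase N))
    (fun lam => (insert N lam.1, if t then insert N lam.2 else lam.2)) ?_ ?_ ?_ ?_ ?_
  · rintro ⟨P, O⟩ h
    simp only [mem_filter, mem_boundedAVee] at h ⊢
    obtain ⟨⟨⟨h1, h2, h3, h4⟩, h5⟩, h6, h7⟩ := h
    refine ⟨⟨fun p hp => h1 p (mem_of_mem_erase hp), erase_subset_erase _ h2,
      fun p hp => h3 p (mem_of_mem_erase hp), fun a ha b hb hab hex => ?_⟩, fun p hp => ?_⟩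
    · have := h4 a (mem_of_mem_erase ha) b (mem_of_mem_erase hb) hab
        (fun h => hex ⟨h.1, mem_erase.2 ⟨ne_of_mem_erase ha, h.2.1⟩, h.2.2⟩)
      exact ⟨this.1, fun h => this.2 (h.imp_left mem_of_mem_erase)⟩
    · have hpP := mem_of_mem_erase hp
      have hpN := lt_of_le_of_ne (h5 p hpP) (ne_of_mem_erase hp)
      rw [hb p (h1 p hpP) hpN]
      intro hex
      rw [← h7] at hex ⊢
      exact h4 N h6 p hpP hpN hex
  · rintro ⟨P, O⟩ h
    simp only [mem_filter, mem_boundedAVee] at h ⊢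
    obtain ⟨⟨h1, h2, h3, h4⟩, h5⟩ := h
    have hNP : N ∉ P := fun h => by have := h5 N h; omega
    have hNO : N ∉ O := fun h => hNP (h2 h)
    have hO : ∀ p, p ∈ (if t then insert N O else O) ↔ (p = N ∧ t) ∨ p ∈ O := by
      intro p; split_ifs with h <;> simp [h]
    refine ⟨⟨⟨fun p hp => ?_, fun p hp => ?_, fun p hp => ?_, fun a ha b hb' hab hex => ?_⟩,
      fun p hp => ?_⟩, mem_insert_self _ _, ?_⟩
    · rcases mem_insert.1 hp with rfl | hp
      exacts [hN, h1 p hp]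
    · rcases (hO p).1 hp with ⟨rfl, -⟩ | hp
      exacts [mem_insert_self _ _, mem_insert_of_mem (h2 hp)]
    · rcases (hO p).1 hp with ⟨rfl, hp'⟩ | hp
      exacts [ht hp', h3 p hp]
    · rw [hO] at hex ⊢
      rcases mem_insert.1 ha with rfl | ha
      · have hbP : b ∈ P := (mem_insert.1 hb').resolve_left hab.ne
        simp only [true_and, hNO, or_false] at hex ⊢
        exact (hb b (h1 b hbP) hab).1 (h5 b hbP) hex
      · have haN : a < N := (h5 a ha).trans_lt hM
        have hbP : b ∈ P := (mem_insert.1 hb').resolve_left (hab.trans haN).ne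
        simp only [haN.ne, false_and, false_or] at hex ⊢
        exact h4 a ha b hbP hab hex
    · rcases mem_insert.1 hp with rfl | hp
      exacts [le_rfl, (h5 p hp).trans hM.le]
    · simp [hO, hNO]
  · rintro ⟨P, O⟩ h
    simp only [mem_filter] at h
    obtain ⟨-, h6, h7⟩ := h
    simp only [insert_erase h6]
    split_ifs with h
    · rw [insert_erase (h7.2 h)]
    · rw [erase_eq_of_notMem (fun h' => h (h7.1 h'))]
  · rintro ⟨P, O⟩ h
    simp only [mem_boundedAVee] at h
    have hNP : N ∉ P := fun h' => by have := h.2 N h'; omega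
    have hNO : N ∉ O := fun h' => hNP (h.1.2.1 h')
    simp only [erase_insert hNP]
    split_ifs
    · rw [erase_insert hNO]
    · rw [erase_eq_of_notMem hNO]
  · rintro ⟨P, O⟩ h
    simp only [mem_filter] at h
    obtain ⟨-, h6, h7⟩ := h
    have hs : P.sum id = N + (P.erase N).sum id := by
      rw [← insert_erase h6, sum_insert (notMem_erase _ _)]; simp
    have hc := card_erase_add_one h6
    have hO : O.card = (O.erase N).card + if t then 1 else 0 := by
      split_ifs with h
      · exact (card_erase_add_one (h7.2 h)).symm
      · rw [erase_eq_of_notMem (fun h' => h (h7.1 h')), add_zero]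
    have hE : (P.filter fun p => Even p).card =
        ((P.erase N).filter fun p => Even p).card + if Even N then 1 else 0 := by
      rw [filter_erase]
      split_ifs with h
      · exact (card_erase_add_one (mem_filter.2 ⟨h6, h⟩)).symm
      · rw [erase_eq_of_notMem (by simp [h]), add_zero]
    have hw : overWeight (P, O) =
        (1 + (if t then 2 else 0) + if Even N then 1 else 0) +
          overWeight (P.erase N, O.erase N) := by
      simp only [overWeight, hO, hE, ← hc]
      split_ifs <;> ring
    rw [hw, hs, pow_add, pow_add]
    ring

theorem filter_notMem_boundedAVee (N : ℕ) :
    (boundedAVee (N + 1)).filter (fun lam => N + 1 ∉ lam.1) = boundedAVee N := by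
  ext ⟨P, O⟩
  simp only [mem_filter, mem_boundedAVee]
  constructor
  · rintro ⟨⟨h, h1⟩, h2⟩
    refine ⟨h, fun p hp => ?_⟩
    have := h1 p hp
    have : p ≠ N + 1 := fun h => h2 (h ▸ hp)
    omega
  · rintro ⟨h, h1⟩
    exact ⟨⟨h, fun p hp => (h1 p hp).trans (Nat.le_succ N)⟩,
      fun h2 => by have := h1 _ h2; omega⟩

theorem boundedGF_succ (N : ℕ) :
    boundedGF q z (N + 1) = boundedGF q z N
      + ∑ lam ∈ (boundedAVee (N + 1)).filter
          (fun lam => N + 1 ∈ lam.1 ∧ (N + 1 ∈ lam.2 ↔ false = true)),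
        z ^ overWeight lam * q ^ lam.1.sum id
      + ∑ lam ∈ (boundedAVee (N + 1)).filter
          (fun lam => N + 1 ∈ lam.1 ∧ (N + 1 ∈ lam.2 ↔ true = true)),
        z ^ overWeight lam * q ^ lam.1.sum id := by
  simp only [Bool.false_eq_true, iff_true, iff_false]
  rw [boundedGF, ← sum_filter_add_sum_filter_not _ (fun lam => N + 1 ∉ lam.1),
    filter_notMem_boundedAVee, ← boundedGF, add_assoc]
  congr 1
  simp only [not_not]
  rw [← sum_filter_not_add_sum_filter _ (fun lam => N + 1 ∈ lam.2), filter_filter, filter_filter]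

theorem boundedGF_succ_of_even {N M : ℕ} (hN : Even (N + 1)) (hM : M < N + 1)
    (hb : ∀ b, 0 < b → b < N + 1 → (b ≤ M ↔
      4 ≤ N + 1 - b ∧ (4 ∣ N + 1 → 5 ≤ N + 1 - b))) :
    boundedGF q z (N + 1) = boundedGF q z N + z ^ 2 * q ^ (N + 1) * boundedGF q z M := by
  rw [boundedGF_succ, sum_filter_mem_boundedAVee q z (N := N + 1) false N.succ_pos hM (by simp)
    (by simpa using hb), filter_false_of_mem, sum_empty, add_zero]
  · simp [hN]
  · rintro ⟨P, O⟩ h ⟨-, h1⟩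
    exact Nat.not_even_iff_odd.2 ((mem_boundedAVee.1 h).1.2.2.1 _ (h1.2 rfl)).1 hN

theorem boundedGF_succ_of_odd {N M M' : ℕ} (hN : Odd (N + 1)) (hN' : 0 < N) (hM : M < N + 1)
    (hM' : M' < N + 1)
    (hb : ∀ b, 0 < b → b < N + 1 → (b ≤ M ↔ 4 ≤ N + 1 - b))
    (hb' : ∀ b, 0 < b → b < N + 1 → (b ≤ M' ↔ (¬(N + 1 = 5 ∧ b = 1) → 5 ≤ N + 1 - b))) :
    boundedGF q z (N + 1) = boundedGF q z N + z * q ^ (N + 1) * boundedGF q z M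
      + z ^ 3 * q ^ (N + 1) * boundedGF q z M' := by
  have hE : ¬Even (N + 1) := Nat.not_even_iff_odd.2 hN
  have h4 : ¬4 ∣ N + 1 := fun h => hE ((show Even 4 by decide).trans_dvd h)
  rw [boundedGF_succ, sum_filter_mem_boundedAVee q z (N := N + 1) false N.succ_pos hM (by simp)
    (by simpa [h4] using hb), sum_filter_mem_boundedAVee q z (N := N + 1) true N.succ_pos hM'
    (fun _ => ⟨hN, by omega⟩) (fun b h1 h2 => by
      rw [hb' b h1 h2]
      simp only [true_and, true_or, forall_const]
      constructor
      · exact fun h h' => ⟨by have := h h'; omega, h h'⟩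
      · exact fun h h' => (h h').2)]
  simp [hE]

theorem boundedGF_one : boundedGF q z 1 = 1 + z * q := by
  rw [show (1 : ℕ) = 0 + 1 from rfl, boundedGF_succ,
    sum_filter_mem_boundedAVee q z (N := 0 + 1) (M := 0) false (by simp) (by simp) (by simp)
    (fun b h1 h2 => by omega), filter_false_of_mem, sum_empty, boundedGF_zero]
  · simp
  · rintro ⟨P, O⟩ h ⟨-, h1⟩
    have := ((mem_boundedAVee.1 h).1.2.2.1 _ (h1.2 rfl)).2
    omega

theorem isBoundedChain_boundedGF :
    IsBoundedChain q z (fun k => boundedGF q z (4 * k - 1))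
      (fun k => if k = 0 then 1 + z * q else boundedGF q z (4 * k))
      (fun k => boundedGF q z (4 * k + 1)) (fun k => boundedGF q z (4 * k + 2))
      (fun k => boundedGF q z (4 * k - 2)) where
  a_zero := boundedGF_zero q z
  b_zero := by simp
  c_zero := boundedGF_one q z
  e_zero := boundedGF_zero q z
  a_succ k := boundedGF_succ_of_odd q z (N := 4 * k + 2) (by grind) (by omega) (by omega)
    (by omega) (fun b _ _ => by omega) (fun b _ _ => by omega)
  b_succ k := by
    simpa [mul_add] using boundedGF_succ_of_even q z (N := 4 * k + 3) (M := 4 * k - 1) (by grind)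
      (by omega) (fun b _ _ => by omega)
  c_succ k := by
    rcases k with _ | k
    · simpa [boundedGF_one] using boundedGF_succ_of_odd q z (N := 4) (M := 1) (M' := 1) (by decide)
        (by omega) (by omega) (by omega) (fun b _ _ => by omega) (fun b _ _ => by omega)
    · simpa [mul_add, add_assoc] using boundedGF_succ_of_odd q z (N := 4 * (k + 2))
        (M := 4 * (k + 1) + 1) (M' := 4 * (k + 1)) (by grind) (by omega) (by omega) (by omega) (fun b _ _ => by omega)
        (fun b _ _ => by omega)
  d_eq k := boundedGF_succ_of_even q z (N := 4 * k + 1) (by grind) (by omega)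
    (fun b _ _ => by omega)
  e_succ k := by
    rw [show 4 * (k + 1) - 2 = 4 * k + 2 by omega]

theorem dvd_boundedGF_sub_one (N : ℕ) : z ∣ boundedGF q z N - 1 := by
  have hmem : (∅, ∅) ∈ boundedAVee N := mem_boundedAVee.2 (by simp [MemAVee])
  rw [boundedGF, ← add_sum_erase _ _ hmem]
  simp only [overWeight, card_empty, filter_empty, sum_empty, mul_zero, add_zero, pow_zero,
    mul_one, add_sub_cancel_left]
  refine dvd_sum fun lam h => (dvd_pow_self z ?_).mul_right _
  obtain ⟨h1, h2⟩ := mem_erase.1 h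
  intro h0
  have hP : lam.1 = ∅ := card_eq_zero.1 (by omega)
  have hO : lam.2 = ∅ := card_eq_zero.1 (by omega)
  exact h1 (Prod.ext hP hO)

theorem pow_dvd_prod_mul_boundedGF_sub (k j : ℕ) :
    q ^ (4 * k) ∣ (∏ i ∈ range j, (1 + z * q ^ (2 * i + 1)) * (1 + (z * q ^ (2 * i + 1)) ^ 2)) *
      boundedGF q (z * q ^ (2 * j)) (4 * k + 2) - boundedGF q z (4 * k + 2) := by
  induction j with
  | zero => simp
  | succ j ih =>
    have h := (isBoundedChain_boundedGF q (z * q ^ (2 * j))).pow_dvd_shift_sub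
      (isBoundedChain_boundedGF q (z * q ^ (2 * j) * q ^ 2)) k
    have := (h.mul_left
      (∏ i ∈ range j, (1 + z * q ^ (2 * i + 1)) * (1 + (z * q ^ (2 * i + 1)) ^ 2))).add ih
    convert this using 1
    rw [prod_range_succ, show z * q ^ (2 * (j + 1)) = z * q ^ (2 * j) * q ^ 2 by ring]
    ring

theorem pow_dvd_prod_sub_boundedGF (k : ℕ) :
    q ^ (4 * k) ∣
      (∏ i ∈ range (2 * k), (1 + z * q ^ (2 * i + 1)) * (1 + (z * q ^ (2 * i + 1)) ^ 2))
        - boundedGF q z (4 * k + 2) := by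
  have h1 := pow_dvd_prod_mul_boundedGF_sub q z k (2 * k)
  have h2 := (Dvd.intro_left z rfl).trans
    (dvd_boundedGF_sub_one q (z * q ^ (2 * (2 * k))) (4 * k + 2))
  rw [← mul_assoc 2 2 k] at h2
  have := h1.sub (h2.mul_left
    (∏ i ∈ range (2 * k), (1 + z * q ^ (2 * i + 1)) * (1 + (z * q ^ (2 * i + 1)) ^ 2)))
  convert this using 1
  ring_nf

/-- The multisets of odd positive integers less than `2 * k` with multiplicities at most 3. -/
noncomputable def thriceOdd : ℕ → Finset (Multiset ℕ)
  | 0 => {0}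
  | k + 1 => (thriceOdd k ×ˢ range 4).image fun x => x.1 + Multiset.replicate x.2 (2 * k + 1)

theorem mem_thriceOdd {k : ℕ} {M : Multiset ℕ} :
    M ∈ thriceOdd k ↔ (∀ p ∈ M, Odd p ∧ p < 2 * k) ∧ ∀ p, M.count p ≤ 3 := by
  induction k generalizing M with
  | zero =>
    simp only [thriceOdd, mem_singleton]
    constructor
    · rintro rfl; simp
    · rintro ⟨h, -⟩
      exact Multiset.eq_zero_of_forall_notMem fun p hp => by have := (h p hp).2; omega
  | succ k ih =>
    simp only [thriceOdd, mem_image, mem_product, ih, mem_range, Prod.exists]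
    constructor
    · rintro ⟨M, c, ⟨⟨h1, h2⟩, hc⟩, rfl⟩
      refine ⟨fun p hp => ?_, fun p => ?_⟩
      · rcases Multiset.mem_add.1 hp with hp | hp
        · exact ⟨(h1 p hp).1, by have := (h1 p hp).2; omega⟩
        · rw [Multiset.eq_of_mem_replicate hp]
          exact ⟨odd_two_mul_add_one k, by omega⟩
      · rw [Multiset.count_add, Multiset.count_replicate]
        split_ifs with h
        · rw [Multiset.count_eq_zero_of_notMem (fun hp => by have := (h1 p hp).2; omega)]
          omega
        · exact h2 p
    · rintro ⟨h1, h2⟩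
      refine ⟨M.filter (· ≠ 2 * k + 1), M.count (2 * k + 1), ⟨⟨fun p hp => ?_, fun p => ?_⟩, ?_⟩, ?_⟩
      · obtain ⟨hp, hne⟩ := Multiset.mem_filter.1 hp
        obtain ⟨⟨r, rfl⟩, hlt⟩ := h1 p hp
        exact ⟨odd_two_mul_add_one r, by omega⟩
      · exact (Multiset.count_le_of_le p (Multiset.filter_le _ _)).trans (h2 p)
      · exact Nat.lt_succ_of_le (h2 _)
      · rw [← Multiset.filter_eq', add_comm]
        exact Multiset.filter_add_not _ _

theorem sum_thriceOdd (k : ℕ) :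
    ∑ M ∈ thriceOdd k, z ^ Multiset.card M * q ^ M.sum =
      ∏ i ∈ range k, (1 + z * q ^ (2 * i + 1)) * (1 + (z * q ^ (2 * i + 1)) ^ 2) := by
  induction k with
  | zero => simp [thriceOdd]
  | succ k ih =>
    rw [thriceOdd, sum_image, sum_product, prod_range_succ, ← ih, sum_mul]
    · refine sum_congr rfl fun M _ => ?_
      simp only [sum_range_succ, range_zero, sum_empty, Multiset.card_add, Multiset.sum_add,
        Multiset.card_replicate, Multiset.sum_replicate, smul_eq_mul]
      ring
    · rintro ⟨M, c⟩ h ⟨M', c'⟩ h' heq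
      simp only [coe_product, Set.mem_prod, mem_coe, mem_thriceOdd] at h h' heq
      have hM : ∀ L : Multiset ℕ, (∀ p ∈ L, Odd p ∧ p < 2 * k) → L.count (2 * k + 1) = 0 :=
        fun L hL => Multiset.count_eq_zero_of_notMem fun hp => by have := (hL _ hp).2; omega
      have hc := congrArg (Multiset.count (2 * k + 1)) heq
      simp only [Multiset.count_add, hM _ h.1.1, hM _ h'.1.1, Multiset.count_replicate_self,
        zero_add] at hc
      subst hc
      rw [add_right_cancel heq]

end Bounded

open Polynomial in
theorem coeff_coeff_sum {α : Type*} (s : Finset α) (w v : α → ℕ) (n m : ℕ) :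
    ((∑ x ∈ s, (C X : ℤ[X][X]) ^ w x * X ^ v x).coeff n).coeff m =
      ((s.filter fun x => v x = n ∧ w x = m).card : ℤ) := by
  simp only [finsetSum_coeff, ← C_pow, coeff_C_mul, coeff_X_pow, Finset.card_filter,
    Nat.cast_sum]
  refine Finset.sum_congr rfl fun x _ => ?_
  by_cases h : v x = n
  · subst h
    simp [coeff_X_pow, eq_comm]
  · simp [h, Ne.symm h]

theorem A2count_eq_card {n N : ℕ} (h : n ≤ N) (m : ℕ) :
    A2count n m =
      ((boundedAVee N).filter fun lam => lam.1.sum id = n ∧ overWeight lam = m).card := by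
  rw [A2count, ← Set.ncard_coe_finset]
  congr 1
  ext lam
  simp only [Set.mem_ofPred_eq, Finset.mem_coe, Finset.mem_filter, mem_boundedAVee]
  constructor
  · rintro ⟨h1, h2, h3⟩
    exact ⟨⟨h1, fun p hp => (Finset.single_le_sum (f := id) (fun _ _ => Nat.zero_le _) hp).trans
      (h2.trans_le h)⟩, h2, h3⟩
  · rintro ⟨⟨h1, -⟩, h2, h3⟩
    exact ⟨h1, h2, h3⟩

theorem B2count_eq_card {n k : ℕ} (h : n < 2 * k) (m : ℕ) :
    B2count n m =
      ((thriceOdd k).filter fun M => M.sum = n ∧ Multiset.card M = m).card := by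
  rw [B2count, ← Set.ncard_coe_finset]
  congr 1
  ext M
  simp only [Set.mem_ofPred_eq, Finset.mem_coe, Finset.mem_filter, mem_thriceOdd]
  constructor
  · rintro ⟨h1, h2, h3, h4⟩
    exact ⟨⟨fun p hp => ⟨(h1 p hp).1, (Multiset.le_sum_of_mem hp).trans_lt (h4.trans_lt h)⟩, h2⟩,
      h4, h3⟩
  · rintro ⟨⟨h1, h2⟩, h4, h3⟩
    exact ⟨fun p hp => ⟨(h1 p hp).1, (h1 p hp).1.pos⟩, h2, h3, h4⟩

/-- **Theorem A2** (Andrews): `A₂(n,m) = B₂(n,m)`. -/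
theorem A2_eq_B2 (n m : ℕ) : A2count n m = B2count n m := by
  have h := pow_dvd_prod_sub_boundedGF (Polynomial.X : Polynomial (Polynomial ℤ))
    (Polynomial.C Polynomial.X) (n + 1)
  rw [← sum_thriceOdd, boundedGF, Polynomial.X_pow_dvd_iff] at h
  have h := congrArg (fun f => Polynomial.coeff f m) (h n (by omega))
  simp only [Polynomial.coeff_sub, Polynomial.coeff_zero, coeff_coeff_sum] at h
  rw [A2count_eq_card (N := 4 * (n + 1) + 2) (by omega),
    B2count_eq_card (k := 2 * (n + 1)) (by omega)]
  exact_mod_cast (sub_eq_zero.1 h).symm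
end
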